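/- Let p be an odd prime, let s ∈ ℤ_p, and let a ∈ ℚ_p with |a|_p > 1. For n ≥ 2 set c_n := (∏_{j=1}^{n−1}(s−1+j)) / (n!·ω_v(a)^n) and, for r ∈ ℕ, set S_r(n) := Σ_{k=1}^{p^r−1} (−1)^k ⟨k+a⟩^{1−s−n}. Then the series Σ_{n=2}^∞ c_n · S_r(n) converges uniformly in r ∈ ℕ, and lim_{r→∞} Σ_{n=2}^∞ c_n · S_r(n) = Σ_{n=2}^∞ c_n · lim_{r→∞} S_r(n), all limits and series involved being convergent in ℚ_p. -/

import Mathlib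

open Filter Topology

noncomputable def teich (p : ℕ) [Fact p.Prime] (u : ℚ_[p]) : ℚ_[p] :=
  limUnder atTop fun n : ℕ => u ^ p ^ n

noncomputable def omegaV (p : ℕ) [Fact p.Prime] (a : ℚ_[p]) : ℚ_[p] :=
  (p : ℚ_[p]) ^ a.valuation * teich p (a * (p : ℚ_[p]) ^ (-a.valuation))

noncomputable def proj (p : ℕ) [Fact p.Prime] (a : ℚ_[p]) : ℚ_[p] :=
  a / omegaV p a

noncomputable def binom (p : ℕ) [Fact p.Prime] (s : ℚ_[p]) (n : ℕ) : ℚ_[p] :=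
  (∏ j ∈ Finset.range n, (s - (j : ℚ_[p]))) / (n.factorial : ℚ_[p])

noncomputable def hpow (p : ℕ) [Fact p.Prime] (a s : ℚ_[p]) : ℚ_[p] :=
  ∑' n : ℕ, binom p s n * (proj p a - 1) ^ n

noncomputable def zetaE (p : ℕ) [Fact p.Prime] (s a : ℚ_[p]) : ℚ_[p] :=
  limUnder atTop fun r : ℕ =>
    ∑ k ∈ Finset.range (p ^ r), (-1 : ℚ_[p]) ^ k * hpow p ((k : ℚ_[p]) + a) (1 - s)

noncomputable def coeffT (p : ℕ) [Fact p.Prime] (s a : ℚ_[p]) (n : ℕ) : ℚ_[p] :=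
  (∏ j ∈ Finset.Icc 1 (n - 1), (s - 1 + (j : ℚ_[p]))) /
    ((n.factorial : ℚ_[p]) * omegaV p a ^ n)

section PadicHelpers

variable {p : ℕ} [Fact p.Prime]

lemma Padic.norm_tsum_le_of_forall_le {f : ℕ → ℚ_[p]} {C : ℝ} (hC : 0 ≤ C)
    (h : ∀ n, ‖f n‖ ≤ C) : ‖∑' n, f n‖ ≤ C := by
  by_cases hf : Summable f
  · exact le_of_tendsto hf.hasSum.tendsto_sum_nat.norm <| Eventually.of_forall fun N =>
      IsUltrametricDist.norm_sum_le_of_forall_le_of_nonneg hC fun i _ => h i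
  · simpa [tsum_eq_zero_of_not_summable hf] using hC

lemma Padic.inv_norm_natCast_le (m : ℕ) : ‖(m : ℚ_[p])‖⁻¹ ≤ m := by
  rcases Nat.eq_zero_or_pos m with rfl | hm
  · simp
  · rw [Padic.norm_eq_zpow_neg_valuation (by exact_mod_cast hm.ne'), Padic.valuation_natCast,
      zpow_neg, inv_inv, zpow_natCast]
    exact_mod_cast Nat.le_of_dvd hm pow_padicValNat_dvd

lemma PadicInt.norm_le_of_dvd {x y : ℤ_[p]} (h : x ∣ y) : ‖y‖ ≤ ‖x‖ := by
  obtain ⟨c, rfl⟩ := h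
  rw [norm_mul]
  exact mul_le_of_le_one_right (norm_nonneg _) c.norm_le_one

lemma PadicInt.prime_dvd_pow_prime_pow_sub (u : ℤ_[p]) (n : ℕ) : (p : ℤ_[p]) ∣ u ^ p ^ n - u := by
  rw [← Ideal.mem_span_singleton, ← PadicInt.maximalIdeal_eq_span_p, ← PadicInt.ker_toZMod,
    RingHom.mem_ker, map_sub, map_pow, ZMod.pow_card_pow, sub_self]

lemma Padic.norm_pow_prime_pow_sub_le {u w : ℚ_[p]} (hu : ‖u‖ ≤ 1) (hw : ‖w‖ ≤ 1)
    (h : ‖u - w‖ < 1) (n : ℕ) : ‖u ^ p ^ n - w ^ p ^ n‖ ≤ ((p : ℝ)⁻¹) ^ (n + 1) := by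
  obtain ⟨u, rfl⟩ : ∃ z : ℤ_[p], (z : ℚ_[p]) = u := ⟨⟨u, hu⟩, rfl⟩
  obtain ⟨w, rfl⟩ : ∃ z : ℤ_[p], (z : ℚ_[p]) = w := ⟨⟨w, hw⟩, rfl⟩
  have hd : (p : ℤ_[p]) ∣ u - w := (PadicInt.norm_lt_one_iff_dvd _).1 h
  have := PadicInt.norm_le_of_dvd (dvd_sub_pow_of_dvd_sub hd n)
  rwa [norm_pow, PadicInt.norm_p] at this

lemma Padic.inv_prime_lt_one : (p : ℝ)⁻¹ < 1 :=
  inv_lt_one_of_one_lt₀ (by exact_mod_cast (Fact.out : p.Prime).one_lt)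

lemma Padic.norm_pow_prime_pow_sub_self_le {u : ℚ_[p]} (hu : ‖u‖ ≤ 1) (n : ℕ) :
    ‖u ^ p ^ n - u‖ ≤ (p : ℝ)⁻¹ := by
  obtain ⟨u, rfl⟩ : ∃ z : ℤ_[p], (z : ℚ_[p]) = u := ⟨⟨u, hu⟩, rfl⟩
  have := PadicInt.norm_le_of_dvd (PadicInt.prime_dvd_pow_prime_pow_sub u n)
  rwa [PadicInt.norm_p] at this

lemma tendsto_teich {u : ℚ_[p]} (hu : ‖u‖ ≤ 1) :
    Tendsto (fun n : ℕ => u ^ p ^ n) atTop (𝓝 (teich p u)) := by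
  have hc : CauchySeq fun n : ℕ => u ^ p ^ n := by
    refine cauchySeq_of_le_geometric (p : ℝ)⁻¹ (p : ℝ)⁻¹ Padic.inv_prime_lt_one fun n => ?_
    have h1 : ‖u - u ^ p‖ < 1 := by
      rw [norm_sub_rev]
      simpa using (Padic.norm_pow_prime_pow_sub_self_le hu 1).trans_lt Padic.inv_prime_lt_one
    have h2 := Padic.norm_pow_prime_pow_sub_le hu
      (by rw [norm_pow]; exact pow_le_one₀ (norm_nonneg _) hu) h1 n
    rw [dist_eq_norm]
    simpa [← pow_mul, pow_succ'] using h2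
  exact tendsto_nhds_limUnder (cauchySeq_tendsto_of_complete hc)

lemma norm_teich_sub_lt_one {u : ℚ_[p]} (hu : ‖u‖ ≤ 1) : ‖teich p u - u‖ < 1 :=
  (le_of_tendsto ((tendsto_teich hu).sub_const u).norm <|
    Eventually.of_forall (Padic.norm_pow_prime_pow_sub_self_le hu)).trans_lt Padic.inv_prime_lt_one

lemma teich_eq_of_norm_sub_lt_one {u w : ℚ_[p]} (hu : ‖u‖ ≤ 1) (hw : ‖w‖ ≤ 1)
    (h : ‖u - w‖ < 1) : teich p u = teich p w := by
  have h0 : Tendsto (fun n : ℕ => u ^ p ^ n - w ^ p ^ n) atTop (𝓝 0) := by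
    refine squeeze_zero_norm (Padic.norm_pow_prime_pow_sub_le hu hw h) ?_
    exact (tendsto_pow_atTop_nhds_zero_of_lt_one (by positivity) Padic.inv_prime_lt_one).comp
      (tendsto_add_atTop_nat 1)
  exact sub_eq_zero.1 (tendsto_nhds_unique ((tendsto_teich hu).sub (tendsto_teich hw)) h0)

lemma Padic.norm_mul_zpow_neg_valuation {a : ℚ_[p]} (ha : a ≠ 0) :
    ‖a * (p : ℚ_[p]) ^ (-a.valuation)‖ = 1 := by
  have hp : (p : ℝ) ≠ 0 := by exact_mod_cast (Fact.out : p.Prime).ne_zero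
  rw [norm_mul, Padic.norm_p_zpow, Padic.norm_eq_zpow_neg_valuation ha, ← zpow_add₀ hp]
  simp

lemma norm_omegaV_sub_lt {a : ℚ_[p]} (ha : a ≠ 0) : ‖omegaV p a - a‖ < ‖a‖ := by
  have hp : (p : ℚ_[p]) ≠ 0 := by exact_mod_cast (Fact.out : p.Prime).ne_zero
  have h1 : omegaV p a - a = (p : ℚ_[p]) ^ a.valuation *
      (teich p (a * (p : ℚ_[p]) ^ (-a.valuation)) - a * (p : ℚ_[p]) ^ (-a.valuation)) := by
    rw [omegaV, mul_sub, mul_left_comm _ a, ← zpow_add₀ hp]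
    simp
  rw [h1, norm_mul, Padic.norm_p_zpow, ← Padic.norm_eq_zpow_neg_valuation ha]
  exact mul_lt_of_lt_one_right (norm_pos_iff.2 ha)
    (norm_teich_sub_lt_one (Padic.norm_mul_zpow_neg_valuation ha).le)

lemma norm_omegaV {a : ℚ_[p]} (ha : a ≠ 0) : ‖omegaV p a‖ = ‖a‖ :=
  Padic.norm_eq_of_norm_sub_lt_right (norm_omegaV_sub_lt ha)

lemma norm_proj_sub_one_lt_one {a : ℚ_[p]} (ha : a ≠ 0) : ‖proj p a - 1‖ < 1 := by
  have hω : omegaV p a ≠ 0 := by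
    rw [← norm_ne_zero_iff, norm_omegaV ha]
    exact norm_ne_zero_iff.2 ha
  rw [proj, div_sub_one hω, norm_div, norm_omegaV ha, norm_sub_rev,
    div_lt_one (norm_pos_iff.2 ha)]
  exact norm_omegaV_sub_lt ha

lemma omegaV_eq_of_norm_sub_lt {a b : ℚ_[p]} (ha : a ≠ 0) (h : ‖b - a‖ < ‖a‖) :
    omegaV p b = omegaV p a := by
  have hn : ‖b‖ = ‖a‖ := Padic.norm_eq_of_norm_sub_lt_right h
  have hb : b ≠ 0 := by
    rw [← norm_ne_zero_iff, hn]
    exact norm_ne_zero_iff.2 ha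
  have hp : (1 : ℝ) < p := by exact_mod_cast (Fact.out : p.Prime).one_lt
  have hv : b.valuation = a.valuation := by
    have h1 := hn
    rw [Padic.norm_eq_zpow_neg_valuation ha, Padic.norm_eq_zpow_neg_valuation hb] at h1
    exact neg_injective (zpow_right_injective₀ (by linarith) hp.ne' h1)
  have hb1 := Padic.norm_mul_zpow_neg_valuation hb
  have ha1 := Padic.norm_mul_zpow_neg_valuation ha
  rw [hv] at hb1
  rw [omegaV, omegaV, hv, teich_eq_of_norm_sub_lt_one hb1.le ha1.le]
  rw [← sub_mul, ← ha1, norm_mul, norm_mul]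
  refine mul_lt_mul_of_pos_right h (norm_pos_iff.2 (zpow_ne_zero _ ?_))
  exact_mod_cast (Fact.out : p.Prime).ne_zero

lemma norm_binom_le_one {t : ℚ_[p]} (ht : ‖t‖ ≤ 1) (n : ℕ) : ‖binom p t n‖ ≤ 1 := by
  obtain ⟨t, rfl⟩ : ∃ z : ℤ_[p], (z : ℚ_[p]) = t := ⟨⟨t, ht⟩, rfl⟩
  have h : ∏ j ∈ Finset.range n, (t - (j : ℤ_[p])) = (n.factorial : ℤ_[p]) * Ring.choose t n := by
    rw [← descPochhammer_eval_eq_prod_range, ← nsmul_eq_mul,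
      ← Ring.descPochhammer_eq_factorial_smul_choose, ← Polynomial.aeval_eq_smeval,
      ← descPochhammer_map (algebraMap ℤ ℤ_[p]), Polynomial.eval_map_algebraMap]
  have h2 : binom p (t : ℚ_[p]) n = (Ring.choose t n : ℤ_[p]) := by
    rw [binom, div_eq_iff (by exact_mod_cast n.factorial_ne_zero), mul_comm]
    have := congrArg (algebraMap ℤ_[p] ℚ_[p]) h
    simpa [map_prod] using this
  rw [h2]
  exact PadicInt.norm_le_one _

lemma norm_binom_mul_pow_le {t x : ℚ_[p]} (ht : ‖t‖ ≤ 1) (m : ℕ) :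
    ‖binom p t m * x ^ m‖ ≤ ‖x‖ ^ m := by
  rw [norm_mul, norm_pow]
  exact mul_le_of_le_one_left (by positivity) (norm_binom_le_one ht m)

lemma summable_binom_mul_pow {t x : ℚ_[p]} (ht : ‖t‖ ≤ 1) (hx : ‖x‖ < 1) :
    Summable fun m : ℕ => binom p t m * x ^ m :=
  .of_norm_bounded (summable_geometric_of_lt_one (norm_nonneg _) hx) (norm_binom_mul_pow_le ht)

lemma norm_hpow_le_one {a t : ℚ_[p]} (ha : a ≠ 0) (ht : ‖t‖ ≤ 1) : ‖hpow p a t‖ ≤ 1 :=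
  Padic.norm_tsum_le_of_forall_le zero_le_one fun m => (norm_binom_mul_pow_le ht m).trans <|
    pow_le_one₀ (norm_nonneg _) (norm_proj_sub_one_lt_one ha).le

lemma Padic.norm_pow_sub_pow_le {x y : ℚ_[p]} (hx : ‖x‖ ≤ 1) (hy : ‖y‖ ≤ 1) (m : ℕ) :
    ‖x ^ m - y ^ m‖ ≤ ‖x - y‖ := by
  obtain ⟨x, rfl⟩ : ∃ z : ℤ_[p], (z : ℚ_[p]) = x := ⟨⟨x, hx⟩, rfl⟩
  obtain ⟨y, rfl⟩ : ∃ z : ℤ_[p], (z : ℚ_[p]) = y := ⟨⟨y, hy⟩, rfl⟩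
  exact PadicInt.norm_le_of_dvd (sub_dvd_pow_sub_pow x y m)

lemma norm_hpow_sub_hpow_le {a b t : ℚ_[p]} (ha : a ≠ 0) (hb : b ≠ 0) (ht : ‖t‖ ≤ 1) :
    ‖hpow p a t - hpow p b t‖ ≤ ‖proj p a - proj p b‖ := by
  have ha1 := norm_proj_sub_one_lt_one ha
  have hb1 := norm_proj_sub_one_lt_one hb
  rw [hpow, hpow, ← (summable_binom_mul_pow ht ha1).tsum_sub (summable_binom_mul_pow ht hb1)]
  refine Padic.norm_tsum_le_of_forall_le (norm_nonneg _) fun m => ?_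
  rw [← mul_sub, norm_mul]
  refine (mul_le_of_le_one_left (norm_nonneg _) (norm_binom_le_one ht m)).trans ?_
  simpa using Padic.norm_pow_sub_pow_le ha1.le hb1.le m

lemma Padic.natCast_add_ne_zero {a : ℚ_[p]} (ha : 1 < ‖a‖) (k : ℕ) : (k : ℚ_[p]) + a ≠ 0 := by
  intro h
  have h1 : a = -(k : ℚ_[p]) := by linear_combination h
  have h2 := IsUltrametricDist.norm_natCast_le_one ℚ_[p] k
  rw [h1, norm_neg] at ha
  linarith

lemma proj_natCast_add {a : ℚ_[p]} (ha : 1 < ‖a‖) (k : ℕ) :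
    proj p ((k : ℚ_[p]) + a) = ((k : ℚ_[p]) + a) / omegaV p a := by
  have h0 : a ≠ 0 := norm_pos_iff.1 (by linarith)
  rw [proj, omegaV_eq_of_norm_sub_lt h0]
  rw [add_sub_cancel_right]
  exact (IsUltrametricDist.norm_natCast_le_one ℚ_[p] k).trans_lt ha

lemma norm_hpow_natCast_add_sub_le {a t : ℚ_[p]} (ha : 1 < ‖a‖) (ht : ‖t‖ ≤ 1) (k l : ℕ) :
    ‖hpow p ((k : ℚ_[p]) + a) t - hpow p ((l : ℚ_[p]) + a) t‖ ≤ ‖(k : ℚ_[p]) - l‖ := by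
  refine (norm_hpow_sub_hpow_le (Padic.natCast_add_ne_zero ha k)
    (Padic.natCast_add_ne_zero ha l) ht).trans ?_
  rw [proj_natCast_add ha, proj_natCast_add ha, ← sub_div, add_sub_add_right_eq_sub, norm_div,
    norm_omegaV (norm_pos_iff.1 (by linarith))]
  exact div_le_self (norm_nonneg _) ha.le

lemma Finset.sum_range_mul_eq_sum_sum {M : Type*} [AddCommMonoid M] (g : ℕ → M) (m n : ℕ) :
    ∑ k ∈ Finset.range (m * n), g k =
      ∑ i ∈ Finset.range n, ∑ k ∈ Finset.range m, g (m * i + k) := by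
  induction n with
  | zero => simp
  | succ n ih => rw [Nat.mul_succ, Finset.sum_range_add, ih, Finset.sum_range_succ]

lemma norm_neg_one_pow_mul (k : ℕ) (x : ℚ_[p]) : ‖(-1 : ℚ_[p]) ^ k * x‖ = ‖x‖ := by
  simp

lemma norm_alternating_sum_succ_sub_le (hodd : p ≠ 2) {f : ℕ → ℚ_[p]}
    (hf : ∀ k l : ℕ, ‖f k - f l‖ ≤ ‖(k : ℚ_[p]) - l‖) (r : ℕ) :
    ‖∑ k ∈ Finset.range (p ^ (r + 1)), (-1 : ℚ_[p]) ^ k * f k -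
      ∑ k ∈ Finset.range (p ^ r), (-1 : ℚ_[p]) ^ k * f k‖ ≤ ((p : ℝ)⁻¹) ^ r := by
  have hp : Odd p := (Fact.out : p.Prime).odd_of_ne_two hodd
  have h1 : ∑ k ∈ Finset.range (p ^ r), (-1 : ℚ_[p]) ^ k * f k =
      ∑ i ∈ Finset.range p, (-1 : ℚ_[p]) ^ i *
        ∑ k ∈ Finset.range (p ^ r), (-1 : ℚ_[p]) ^ k * f k := by
    rw [← Finset.sum_mul, neg_one_geom_sum, if_neg (Nat.not_even_iff_odd.2 hp), one_mul]
  have h2 : ∑ k ∈ Finset.range (p ^ (r + 1)), (-1 : ℚ_[p]) ^ k * f k =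
      ∑ i ∈ Finset.range p, (-1 : ℚ_[p]) ^ i *
        ∑ k ∈ Finset.range (p ^ r), (-1 : ℚ_[p]) ^ k * f (p ^ r * i + k) := by
    rw [pow_succ, Finset.sum_range_mul_eq_sum_sum]
    refine Finset.sum_congr rfl fun i _ => ?_
    rw [Finset.mul_sum]
    refine Finset.sum_congr rfl fun k _ => ?_
    rw [pow_add, pow_mul, (hp.pow : Odd (p ^ r)).neg_one_pow, mul_assoc]
  rw [h1, h2, ← Finset.sum_sub_distrib]
  refine IsUltrametricDist.norm_sum_le_of_forall_le_of_nonneg (by positivity) fun i _ => ?_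
  rw [← mul_sub, norm_neg_one_pow_mul, ← Finset.sum_sub_distrib]
  refine IsUltrametricDist.norm_sum_le_of_forall_le_of_nonneg (by positivity) fun k _ => ?_
  rw [← mul_sub, norm_neg_one_pow_mul]
  refine (hf _ _).trans ?_
  push_cast
  rw [add_sub_cancel_right, norm_mul, norm_pow, Padic.norm_p]
  exact mul_le_of_le_one_right (by positivity) (IsUltrametricDist.norm_natCast_le_one _ i)

lemma exists_tendsto_alternating_sum (hodd : p ≠ 2) {f : ℕ → ℚ_[p]}
    (hf : ∀ k l : ℕ, ‖f k - f l‖ ≤ ‖(k : ℚ_[p]) - l‖) :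
    ∃ L, Tendsto (fun r : ℕ => ∑ k ∈ Finset.Ico 1 (p ^ r), (-1 : ℚ_[p]) ^ k * f k) atTop
      (𝓝 L) := by
  have hc : CauchySeq fun r : ℕ => ∑ k ∈ Finset.range (p ^ r), (-1 : ℚ_[p]) ^ k * f k := by
    refine cauchySeq_of_le_geometric (p : ℝ)⁻¹ 1 Padic.inv_prime_lt_one fun r => ?_
    rw [dist_eq_norm, norm_sub_rev, one_mul]
    exact norm_alternating_sum_succ_sub_le hodd hf r
  obtain ⟨L, hL⟩ := cauchySeq_tendsto_of_complete hc
  refine ⟨L - f 0, (hL.sub_const (f 0)).congr fun r => ?_⟩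
  rw [Finset.range_eq_Ico, Finset.sum_eq_sum_Ico_succ_bot (pow_pos (Fact.out : p.Prime).pos r)]
  simp

lemma coeffT_add_two (s a : ℚ_[p]) (n : ℕ) :
    coeffT p s a (n + 2) =
      (-1) ^ (n + 1) * binom p (-s) (n + 1) / (((n + 2 : ℕ) : ℚ_[p]) * omegaV p a ^ (n + 2)) := by
  have h : ∏ j ∈ Finset.Icc 1 (n + 2 - 1), (s - 1 + (j : ℚ_[p])) =
      (-1) ^ (n + 1) * ∏ j ∈ Finset.range (n + 1), (-s - (j : ℚ_[p])) := by
    rw [show Finset.Icc 1 (n + 2 - 1) = Finset.Ico 1 (n + 2) by ext; simp; omega,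
      Finset.prod_Ico_eq_prod_range, show n + 2 - 1 = n + 1 by omega,
      ← Finset.card_range (n + 1), ← Finset.prod_const, Finset.card_range,
      ← Finset.prod_mul_distrib]
    refine Finset.prod_congr rfl fun j _ => ?_
    push_cast
    ring
  rw [coeffT, h, binom, Nat.factorial_succ (n + 1)]
  have : ((n + 1).factorial : ℚ_[p]) ≠ 0 := by exact_mod_cast (n + 1).factorial_ne_zero
  push_cast
  rw [mul_div_assoc', div_div]
  congr 1
  ring

lemma norm_coeffT_add_two_le {s a : ℚ_[p]} (hs : ‖s‖ ≤ 1) (ha : a ≠ 0) (n : ℕ) :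
    ‖coeffT p s a (n + 2)‖ ≤ ((n + 2 : ℕ) : ℝ) ^ 1 * (‖a‖⁻¹) ^ (n + 2) := by
  rw [coeffT_add_two, norm_div, norm_neg_one_pow_mul, norm_mul, norm_pow, norm_omegaV ha,
    div_eq_mul_inv, mul_inv, inv_pow, pow_one]
  refine (mul_le_of_le_one_left (by positivity)
    (norm_binom_le_one (by rwa [norm_neg]) _)).trans ?_
  exact mul_le_mul_of_nonneg_right (Padic.inv_norm_natCast_le _) (by positivity)

lemma norm_one_sub_sub_natCast_le_one {s : ℚ_[p]} (hs : ‖s‖ ≤ 1) (n : ℕ) :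
    ‖1 - s - (n : ℚ_[p])‖ ≤ 1 := by
  obtain ⟨s, rfl⟩ : ∃ z : ℤ_[p], (z : ℚ_[p]) = s := ⟨⟨s, hs⟩, rfl⟩
  exact_mod_cast (1 - s - (n : ℤ_[p])).norm_le_one

end PadicHelpers

/-- Proposition on uniform convergence: with
`c_n = [∏_{j=1}^{n-1}(s-1+j)]/(n! ω_v(a)^n)` and
`S_r(n) = ∑_{k=1}^{p^r-1} (-1)^k ⟨k+a⟩^{1-s-n}`, the series `∑_{n≥2} c_n S_r(n)` converges
uniformly in `r ∈ ℕ`, the inner limits `lim_{r→∞} S_r(n)` exist, and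
`lim_{r→∞} ∑_{n≥2} c_n S_r(n) = ∑_{n≥2} c_n lim_{r→∞} S_r(n)`. -/
theorem padic_hurwitz_euler_uniform_convergence_interchange
    (p : ℕ) [Fact p.Prime] (hodd : p ≠ 2)
    (s : ℚ_[p]) (hs : ‖s‖ ≤ 1)
    (a : ℚ_[p]) (ha : 1 < ‖a‖)
    (S : ℕ → ℕ → ℚ_[p])
    (hS : ∀ r n, S r n =
      ∑ k ∈ Finset.Ico 1 (p ^ r),
        (-1 : ℚ_[p]) ^ k * hpow p ((k : ℚ_[p]) + a) (1 - s - (n : ℚ_[p]))) :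
    (∀ r : ℕ, Summable fun n : ℕ => coeffT p s a (n + 2) * S r (n + 2)) ∧
    TendstoUniformly
      (fun N : ℕ => fun r : ℕ => ∑ n ∈ Finset.range N, coeffT p s a (n + 2) * S r (n + 2))
      (fun r : ℕ => ∑' n : ℕ, coeffT p s a (n + 2) * S r (n + 2)) atTop ∧
    (∀ n : ℕ, ∃ L : ℚ_[p], Tendsto (fun r : ℕ => S r n) atTop (𝓝 L)) ∧
    Summable (fun n : ℕ =>
      coeffT p s a (n + 2) * limUnder atTop (fun r : ℕ => S r (n + 2))) ∧
    Tendsto (fun r : ℕ => ∑' n : ℕ, coeffT p s a (n + 2) * S r (n + 2)) atTop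
      (𝓝 (∑' n : ℕ, coeffT p s a (n + 2) * limUnder atTop (fun r : ℕ => S r (n + 2)))) := by
  have h0 : a ≠ 0 := norm_pos_iff.1 (by linarith)
  have ht : ∀ n : ℕ, ‖1 - s - (n : ℚ_[p])‖ ≤ 1 := norm_one_sub_sub_natCast_le_one hs
  have hS1 : ∀ r n, ‖S r n‖ ≤ 1 := fun r n => by
    rw [hS]
    refine IsUltrametricDist.norm_sum_le_of_forall_le_of_nonneg zero_le_one fun k _ => ?_
    rw [norm_neg_one_pow_mul]
    exact norm_hpow_le_one (Padic.natCast_add_ne_zero ha k) (ht n)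
  have hL : ∀ n : ℕ, ∃ L : ℚ_[p], Tendsto (fun r : ℕ => S r n) atTop (𝓝 L) := fun n => by
    simp only [hS]
    exact exists_tendsto_alternating_sum hodd (norm_hpow_natCast_add_sub_le ha (ht n))
  have hlim : ∀ n : ℕ, Tendsto (fun r : ℕ => S r n) atTop
      (𝓝 (limUnder atTop fun r : ℕ => S r n)) := fun n => tendsto_nhds_limUnder (hL n)
  have hlim1 : ∀ n : ℕ, ‖limUnder atTop fun r : ℕ => S r n‖ ≤ 1 := fun n =>
    le_of_tendsto (hlim n).norm (Eventually.of_forall fun r => hS1 r n)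
  have hu : Summable fun n : ℕ => ((n + 2 : ℕ) : ℝ) ^ 1 * (‖a‖⁻¹) ^ (n + 2) := by
    refine (summable_nat_add_iff (f := fun n : ℕ => (n : ℝ) ^ 1 * (‖a‖⁻¹) ^ n) 2).2 ?_
    refine summable_pow_mul_geometric_of_norm_lt_one 1 ?_
    rw [norm_inv, norm_norm]
    exact inv_lt_one_of_one_lt₀ ha
  have hb : ∀ (n : ℕ) (x : ℚ_[p]), ‖x‖ ≤ 1 → ‖coeffT p s a (n + 2) * x‖ ≤
      ((n + 2 : ℕ) : ℝ) ^ 1 * (‖a‖⁻¹) ^ (n + 2) := fun n x hx => by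
    rw [norm_mul]
    exact (mul_le_of_le_one_right (norm_nonneg _) hx).trans (norm_coeffT_add_two_le hs h0 n)
  refine ⟨fun r => .of_norm_bounded hu fun n => hb n _ (hS1 r _),
    tendstoUniformly_tsum_nat hu fun n r => hb n _ (hS1 r _), hL,
    .of_norm_bounded hu fun n => hb n _ (hlim1 _), ?_⟩
  exact tendsto_tsum_of_dominated_convergence hu (fun n => (hlim (n + 2)).const_mul _)
    (Eventually.of_forall fun r n => hb n _ (hS1 r _))
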